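/- arXiv:2003.01974 — 8 statements merged into one kernel-verified Lean document; each statement's English description precedes it below -/
import Mathlib

section
/- The greedy assignment g of a temporal interaction network is itself a flow assignment; that is, g satisfies 0 ≤ g(i) ≤ q(i) for every i ∈ I, g(i) = q(i) whenever src(i) = s, and for every i ∈ I with src(i) ≠ s, g(i) ≤ Σ{g(j) : dest(j) = src(i), τ(j) < τ(i)} − Σ{g(j) : src(j) = src(i), τ(j) < τ(i)}. -/
noncomputable section
attribute [local instance] Classical.propDecidable

/-- A temporal interaction network over an ambient vertex type `ν` and an
ambient interaction-index type `ι`: a finite vertex set `V`, a finite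
interaction set `I`, a distinguished source `s` and sink `t`, and, for each
interaction, a source vertex, a destination vertex, a timestamp and a
quantity. -/
structure TIN (ν ι : Type) where
  V : Finset ν
  I : Finset ι
  s : ν
  t : ν
  src : ι → ν
  dest : ι → ν
  τ : ι → ℝ
  q : ι → ℝ

namespace TIN

variable {ν ι : Type}

/-- The axioms of a temporal interaction network: `s,t ∈ V` are distinct, every
interaction joins two distinct vertices of `V`, quantities are nonnegative,
distinct interactions have distinct timestamps, no interaction enters `s`
and no interaction leaves `t`. -/
def Valid (N : TIN ν ι) : Prop :=
  N.s ∈ N.V ∧ N.t ∈ N.V ∧ N.s ≠ N.t ∧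
  (∀ i ∈ N.I, N.src i ∈ N.V ∧ N.dest i ∈ N.V ∧ N.dest i ≠ N.src i ∧
      0 ≤ N.q i ∧ N.dest i ≠ N.s ∧ N.src i ≠ N.t) ∧
  (∀ i ∈ N.I, ∀ j ∈ N.I, N.τ i = N.τ j → i = j)

/-- A flow assignment: (i) `0 ≤ x i ≤ q i`; (ii) `x i = q i` when `src i = s`;
(iii) for `src i ≠ s`, `x i` is at most the quantity received by `src i`
strictly before time `τ i` minus the quantity sent by `src i` strictly
before time `τ i`. -/
def IsFlow (N : TIN ν ι) (x : ι → ℝ) : Prop :=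
  (∀ i ∈ N.I, 0 ≤ x i ∧ x i ≤ N.q i) ∧
  (∀ i ∈ N.I, N.src i = N.s → x i = N.q i) ∧
  (∀ i ∈ N.I, N.src i ≠ N.s →
    x i ≤ (∑ j ∈ N.I.filter fun j => N.dest j = N.src i ∧ N.τ j < N.τ i, x j)
        - (∑ j ∈ N.I.filter fun j => N.src j = N.src i ∧ N.τ j < N.τ i, x j))

/-- The value of an assignment: the total quantity arriving at the sink. -/
def val (N : TIN ν ι) (x : ι → ℝ) : ℝ :=
  ∑ i ∈ N.I.filter fun i => N.dest i = N.t, x i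

/-- The maximum flow: the supremum of the values of all flow assignments. -/
def maxFlow (N : TIN ν ι) : ℝ :=
  sSup {r : ℝ | ∃ x, N.IsFlow x ∧ N.val x = r}

/-- One step of the greedy algorithm: the state consists of the assignment
built so far and the buffers; processing interaction `i` transfers the
maximal possible amount from the buffer of `src i` to the buffer of
`dest i` (the source `s` having unlimited supply). -/
def greedyStep (N : TIN ν ι) (gB : (ι → ℝ) × (ν → ℝ)) (i : ι) : (ι → ℝ) × (ν → ℝ) :=
  let amt : ℝ := if N.src i = N.s then N.q i else min (N.q i) (gB.2 (N.src i))
  (Function.update gB.1 i amt,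
   fun v => gB.2 v + (if v = N.dest i then amt else 0)
          - (if v = N.src i ∧ N.src i ≠ N.s then amt else 0))

/-- The interactions listed in increasing order of timestamp. -/
def sortedI (N : TIN ν ι) : List ι :=
  N.I.toList.mergeSort fun a b => decide (N.τ a ≤ N.τ b)

/-- The greedy assignment: process the interactions in increasing order of
timestamp, starting with all buffers at `0`. -/
def greedy (N : TIN ν ι) : ι → ℝ :=
  (N.sortedI.foldl N.greedyStep (fun _ => 0, fun _ => 0)).1

end TIN

namespace TIN

variable {ν ι : Type}

/-- The quantity transferred by interaction `i` from the buffers `B`. -/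
def transfer (N : TIN ν ι) (B : ν → ℝ) (i : ι) : ℝ :=
  if N.src i = N.s then N.q i else min (N.q i) (B (N.src i))

/-- The state of the greedy algorithm after processing the list `l`. -/
def greedyState (N : TIN ν ι) (l : List ι) : (ι → ℝ) × (ν → ℝ) :=
  l.foldl N.greedyStep (fun _ => 0, fun _ => 0)

theorem greedyState_concat_fst (N : TIN ν ι) (l : List ι) (i : ι) :
    (N.greedyState (l ++ [i])).1 =
      Function.update (N.greedyState l).1 i (N.transfer (N.greedyState l).2 i) := by
  simp [greedyState, greedyStep, transfer]

theorem greedyState_concat_snd (N : TIN ν ι) (l : List ι) (i : ι) (v : ν) :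
    (N.greedyState (l ++ [i])).2 v =
      (N.greedyState l).2 v
        + (if v = N.dest i then N.transfer (N.greedyState l).2 i else 0)
        - (if v = N.src i ∧ N.src i ≠ N.s then N.transfer (N.greedyState l).2 i else 0) := by
  simp [greedyState, greedyStep, transfer]

theorem greedyState_append_fst_of_notMem (N : TIN ν ι) (l l' : List ι) {j : ι} (hj : j ∉ l') :
    (N.greedyState (l ++ l')).1 j = (N.greedyState l).1 j := by
  induction l' using List.reverseRecOn with
  | nil => simp
  | append_singleton l' a ih =>
    simp only [List.mem_append, List.mem_singleton, not_or] at hj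
    rw [← List.append_assoc, greedyState_concat_fst, Function.update_of_ne hj.2, ih hj.1]

theorem transfer_nonneg (N : TIN ν ι) {B : ν → ℝ} {i : ι} (hq : 0 ≤ N.q i)
    (hB : ∀ v, v ≠ N.s → 0 ≤ B v) : 0 ≤ N.transfer B i := by
  unfold transfer
  split_ifs with h
  · exact hq
  · exact le_min hq (hB _ h)

theorem transfer_le (N : TIN ν ι) (B : ν → ℝ) (i : ι) : N.transfer B i ≤ N.q i := by
  unfold transfer
  split_ifs with h
  · exact le_rfl
  · exact min_le_left _ _

theorem transfer_le_buffer (N : TIN ν ι) (B : ν → ℝ) {i : ι} (h : N.src i ≠ N.s) :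
    N.transfer B i ≤ B (N.src i) := by
  rw [transfer, if_neg h]
  exact min_le_right _ _

theorem greedyState_snd_nonneg (N : TIN ν ι) (l : List ι) (hl : ∀ i ∈ l, 0 ≤ N.q i)
    (v : ν) (hv : v ≠ N.s) : 0 ≤ (N.greedyState l).2 v := by
  induction l using List.reverseRecOn generalizing v with
  | nil => simp [greedyState]
  | append_singleton l a ih =>
    have ih' := ih fun i hi => hl i (by simp [hi])
    have h0 := N.transfer_nonneg (hl a (by simp)) ih'
    have hB := ih' v hv
    rw [greedyState_concat_snd]
    by_cases hs : v = N.src a ∧ N.src a ≠ N.s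
    · have h1 := N.transfer_le_buffer (N.greedyState l).2 hs.2
      rw [← hs.1] at h1
      rw [if_pos hs]
      split_ifs <;> linarith
    · rw [if_neg hs]
      split_ifs <;> linarith

/-- The buffer of a vertex is the quantity received minus the quantity sent. -/
theorem greedyState_snd_eq (N : TIN ν ι) (l : List ι) (hl : l.Nodup) {v : ν} (hv : v ≠ N.s) :
    (N.greedyState l).2 v =
      (∑ j ∈ l.toFinset, if N.dest j = v then (N.greedyState l).1 j else 0)
        - ∑ j ∈ l.toFinset, if N.src j = v then (N.greedyState l).1 j else 0 := by
  induction l using List.reverseRecOn with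
  | nil => simp [greedyState]
  | append_singleton l a ih =>
    obtain ⟨hl', -, hd⟩ := List.nodup_append.1 hl
    have ha : a ∉ l := fun h => hd a h a (by simp) rfl
    have hset : (l ++ [a]).toFinset = insert a l.toFinset := by
      ext; simp
    have hold : ∀ j ∈ l.toFinset,
        (N.greedyState (l ++ [a])).1 j = (N.greedyState l).1 j := fun j hj =>
      N.greedyState_append_fst_of_notMem l [a] (by
        rintro h
        rw [List.mem_singleton] at h
        exact ha (h ▸ List.mem_toFinset.1 hj))
    have hsum : ∀ f : ι → ν,
        (∑ j ∈ l.toFinset, if f j = v then (N.greedyState (l ++ [a])).1 j else 0) =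
          ∑ j ∈ l.toFinset, if f j = v then (N.greedyState l).1 j else 0 := fun f =>
      Finset.sum_congr rfl fun j hj => by rw [hold j hj]
    have hsrc : (v = N.src a ∧ N.src a ≠ N.s) ↔ N.src a = v :=
      ⟨fun h => h.1.symm, fun h => ⟨h.symm, h ▸ hv⟩⟩
    rw [hset, Finset.sum_insert (by simpa using ha), Finset.sum_insert (by simpa using ha),
      hsum, hsum, greedyState_concat_snd, ih hl', greedyState_concat_fst, Function.update_self]
    simp only [hsrc, @eq_comm _ v (N.dest a)]
    ring

theorem mem_sortedI (N : TIN ν ι) {i : ι} : i ∈ N.sortedI ↔ i ∈ N.I := by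
  simp [sortedI]

theorem nodup_sortedI (N : TIN ν ι) : N.sortedI.Nodup :=
  (List.mergeSort_perm _ _).nodup_iff.2 N.I.nodup_toList

theorem pairwise_sortedI (N : TIN ν ι) : N.sortedI.Pairwise fun a b => N.τ a ≤ N.τ b := by
  have h := List.pairwise_mergeSort (le := fun a b => decide (N.τ a ≤ N.τ b))
    (fun a b c hab hbc => by simp only [decide_eq_true_eq] at *; exact hab.trans hbc)
    (fun a b => by simpa using le_total (N.τ a) (N.τ b)) N.I.toList
  simpa [sortedI] using h

/-- The greedy assignment at `i` is the transfer from the buffers reached after processing the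
interactions earlier than `i`, and it agrees with the partial assignment on those. -/
theorem exists_greedy_prefix (N : TIN ν ι)
    (hτ : ∀ i ∈ N.I, ∀ j ∈ N.I, N.τ i = N.τ j → i = j) {i : ι} (hi : i ∈ N.I) :
    ∃ l : List ι, l.Nodup ∧ (∀ j, j ∈ l ↔ j ∈ N.I ∧ N.τ j < N.τ i) ∧
      N.greedy i = N.transfer (N.greedyState l).2 i ∧
      ∀ j ∈ l, N.greedy j = (N.greedyState l).1 j := by
  obtain ⟨l, l', h⟩ := List.append_of_mem (N.mem_sortedI.2 hi)
  have hnd := N.nodup_sortedI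
  have hpw := N.pairwise_sortedI
  have hmem : ∀ j, j ∈ N.I ↔ j ∈ l ∨ j = i ∨ j ∈ l' := fun j => by
    rw [← N.mem_sortedI, h]; simp
  rw [h, List.nodup_append, List.nodup_cons] at hnd
  rw [h, List.pairwise_append, List.pairwise_cons] at hpw
  obtain ⟨hl, ⟨hil', -⟩, hd⟩ := hnd
  obtain ⟨-, ⟨hle', -⟩, hle⟩ := hpw
  refine ⟨l, hl, fun j => ⟨fun hj => ?_, fun hj => ?_⟩, ?_, fun j hj => ?_⟩
  · have hjI := (hmem j).2 (Or.inl hj)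
    exact ⟨hjI, lt_of_le_of_ne (hle j hj i (by simp)) fun he =>
      hd j hj i (by simp) (hτ j hjI i hi he)⟩
  · rcases (hmem j).1 hj.1 with hjl | rfl | hjl
    · exact hjl
    · exact absurd hj.2 (lt_irrefl _)
    · exact absurd hj.2 (not_lt.2 (hle' j hjl))
  · change (N.greedyState N.sortedI).1 i = _
    rw [h, List.append_cons, greedyState_append_fst_of_notMem _ _ _ hil',
      greedyState_concat_fst, Function.update_self]
  · change (N.greedyState N.sortedI).1 j = _
    rw [h, greedyState_append_fst_of_notMem]
    exact fun hj' => hd j hj j hj' rfl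

end TIN

/-- The greedy assignment of a temporal interaction network is
itself a flow assignment. -/
theorem greedy_isFlow (ν ι : Type) (N : TIN ν ι) (hN : N.Valid) :
    N.IsFlow N.greedy := by
  obtain ⟨-, -, -, hI, hτ⟩ := hN
  refine ⟨fun i hi => ?_, fun i hi hs => ?_, fun i hi hs => ?_⟩ <;>
    obtain ⟨l, hnd, hl, hgi, hgl⟩ := N.exists_greedy_prefix hτ hi
  · rw [hgi]
    exact ⟨N.transfer_nonneg (hI i hi).2.2.2.1
      (N.greedyState_snd_nonneg l fun j hj => (hI j ((hl j).1 hj).1).2.2.2.1),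
      N.transfer_le _ i⟩
  · rw [hgi, TIN.transfer, if_pos hs]
  · have hsum : ∀ f : ι → ν,
        (∑ j ∈ N.I.filter fun j => f j = N.src i ∧ N.τ j < N.τ i, N.greedy j) =
          ∑ j ∈ l.toFinset, if f j = N.src i then (N.greedyState l).1 j else 0 := fun f => by
      rw [← Finset.sum_filter]
      refine Finset.sum_congr ?_ fun j hj => hgl j ?_
      · ext j
        simp only [Finset.mem_filter, List.mem_toFinset, hl]
        tauto
      · exact List.mem_toFinset.1 (Finset.mem_filter.1 hj).1
    rw [hsum, hsum, ← N.greedyState_snd_eq l hnd hs, hgi]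
    exact N.transfer_le_buffer _ hs
end
end

section
/- Let a temporal interaction network be such that the directed graph on V with edge set {(src(i), dest(i)) : i ∈ I} is acyclic, and such that every vertex v ∈ V \ {s, t} has exactly one outgoing edge, i.e., the set {dest(i) : i ∈ I, src(i) = v} is a singleton for every v ∈ V \ {s, t}. Then the greedy algorithm computes the maximum flow: val(g) = sup{val(x) : x a flow assignment}. -/
noncomputable section
attribute [local instance] Classical.propDecidable

namespace TIN

variable {ν ι : Type}

/-- What the greedy algorithm has computed after processing a list of interactions with
strictly increasing timestamps. -/
theorem foldl_greedyStep_spec (N : TIN ν ι) (l : List ι)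
    (hl : l.Pairwise fun a b => N.τ a < N.τ b) :
    let st := l.foldl N.greedyStep (fun _ => 0, fun _ => 0)
    (∀ v, v ≠ N.s → st.2 v = (∑ j ∈ l.toFinset with N.dest j = v, st.1 j)
        - ∑ j ∈ l.toFinset with N.src j = v, st.1 j) ∧
    ∀ i ∈ l, st.1 i = if N.src i = N.s then N.q i else
      min (N.q i) ((∑ j ∈ l.toFinset with N.dest j = N.src i ∧ N.τ j < N.τ i, st.1 j)
        - ∑ j ∈ l.toFinset with N.src j = N.src i ∧ N.τ j < N.τ i, st.1 j) := by
  induction l using List.reverseRecOn with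
  | nil => simp
  | append_singleton l a ih =>
    rw [List.pairwise_append] at hl
    obtain ⟨hl, -, hla⟩ := hl
    have hlt : ∀ j ∈ l, N.τ j < N.τ a := fun j hj => hla j hj a (by simp)
    have ha : a ∉ l := fun h => lt_irrefl _ (hlt a h)
    obtain ⟨hB, hg⟩ := ih hl
    simp only [List.foldl_append, List.foldl_cons, List.foldl_nil]
    set st := l.foldl N.greedyStep (fun _ => 0, fun _ => 0) with hst
    set amt : ℝ := if N.src a = N.s then N.q a else min (N.q a) (st.2 (N.src a)) with hamt
    have hfin : (l ++ [a]).toFinset = insert a l.toFinset := by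
      ext j; simp
    have hstep1 : (N.greedyStep st a).1 = Function.update st.1 a amt := rfl
    have hstep2 : ∀ v, (N.greedyStep st a).2 v = st.2 v + (if v = N.dest a then amt else 0)
          - (if v = N.src a ∧ N.src a ≠ N.s then amt else 0) := fun _ => rfl
    have hold : ∀ j ∈ l, Function.update st.1 a amt j = st.1 j := fun j hj =>
      Function.update_of_ne (fun h : j = a => ha (h ▸ hj)) _ _
    have hsum : ∀ (p : ι → Prop) [DecidablePred p], ∑ j ∈ l.toFinset with p j, Function.update st.1 a amt j
        = ∑ j ∈ l.toFinset with p j, st.1 j := fun p _ =>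
      Finset.sum_congr rfl fun j hj => hold j (by simpa using (Finset.mem_filter.1 hj).1)
    have hsum' : ∀ (p : ι → Prop) [DecidablePred p],
        ∑ j ∈ insert a l.toFinset with p j, Function.update st.1 a amt j
        = (if p a then amt else 0) + ∑ j ∈ l.toFinset with p j, st.1 j := by
      intro p _
      rw [Finset.filter_insert]
      split_ifs with h
      · rw [Finset.sum_insert (by simp [ha]), hsum, Function.update_self]
      · rw [hsum, zero_add]
    rw [hfin, hstep1]
    refine ⟨fun v hv => ?_, fun i hi => ?_⟩
    · rw [hstep2, hsum', hsum', hB v hv]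
      have h1 : (v = N.src a ∧ N.src a ≠ N.s) ↔ N.src a = v :=
        ⟨fun h => h.1.symm, fun h => ⟨h.symm, h ▸ hv⟩⟩
      rw [if_congr h1 rfl rfl, if_congr (eq_comm (a := v)) rfl rfl]
      ring
    · rw [hsum', hsum']
      rcases List.mem_append.1 hi with hi | hi
      · have := (hlt i hi).not_gt
        simp only [this, and_false, if_false, zero_add]
        rw [hold i hi]
        exact hg i hi
      · obtain rfl : i = a := by simpa using hi
        rw [Function.update_self]
        simp only [lt_irrefl, and_false, if_false, zero_add]
        have hf : ∀ p : ι → Prop, l.toFinset.filter (fun j => p j ∧ N.τ j < N.τ i)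
            = l.toFinset.filter p := fun p =>
          Finset.filter_congr fun j hj => and_iff_left (hlt j (by simpa using hj))
        rw [hf, hf, hamt]
        split_ifs with h
        · rfl
        · rw [hB _ h]

/-- The recursive equation that the greedy assignment satisfies. -/
theorem greedy_apply (N : TIN ν ι) (hN : N.Valid) {i : ι} (hi : i ∈ N.I) :
    N.greedy i = if N.src i = N.s then N.q i else
      min (N.q i) ((∑ j ∈ N.I with N.dest j = N.src i ∧ N.τ j < N.τ i, N.greedy j)
        - ∑ j ∈ N.I with N.src j = N.src i ∧ N.τ j < N.τ i, N.greedy j) := by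
  have hperm : N.sortedI.Perm N.I.toList := List.mergeSort_perm _ _
  have hmem : ∀ j, j ∈ N.sortedI ↔ j ∈ N.I := fun j => by
    rw [hperm.mem_iff, Finset.mem_toList]
  have hnodup : N.sortedI.Nodup := hperm.nodup_iff.2 N.I.nodup_toList
  have hle : N.sortedI.Pairwise fun a b => N.τ a ≤ N.τ b := by
    have := List.pairwise_mergeSort (le := fun a b => decide (N.τ a ≤ N.τ b))
      (fun a b c hab hbc => by
        simp only [decide_eq_true_eq] at *; exact hab.trans hbc)
      (fun a b => by simpa using le_total (N.τ a) (N.τ b)) N.I.toList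
    simpa [sortedI] using this
  have hlt : N.sortedI.Pairwise fun a b => N.τ a < N.τ b := by
    refine (hle.and hnodup).imp_of_mem fun {a b} ha hb h => lt_of_le_of_ne h.1 fun heq => h.2 ?_
    exact hN.2.2.2.2 a ((hmem a).1 ha) b ((hmem b).1 hb) heq
  have hfin : N.sortedI.toFinset = N.I := by
    ext j; rw [List.mem_toFinset, hmem]
  have := (N.foldl_greedyStep_spec N.sortedI hlt).2 i ((hmem i).2 hi)
  rwa [hfin] at this

/-- A set of interactions which is closed under passing to earlier interactions. -/
def IsInitial (N : TIN ν ι) (A : Finset ι) : Prop :=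
  A ⊆ N.I ∧ ∀ j ∈ N.I, ∀ i ∈ A, N.τ j < N.τ i → j ∈ A

/-- If `a` is last in an initial set, the interactions before `a` are the other members. -/
theorem IsInitial.filter_lt {N : TIN ν ι} (hN : N.Valid) {A : Finset ι} {a : ι} (ha : a ∉ A)
    (hmax : ∀ j ∈ A, N.τ j ≤ N.τ a) (hA : N.IsInitial (insert a A)) (p : ι → Prop) :
    (N.I.filter fun j => p j ∧ N.τ j < N.τ a) = A.filter p := by
  ext j
  simp only [Finset.mem_filter]
  constructor
  · rintro ⟨hj, hp, hlt⟩
    rcases Finset.mem_insert.1 (hA.2 j hj a (Finset.mem_insert_self _ _) hlt) with rfl | h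
    · exact absurd hlt (lt_irrefl _)
    · exact ⟨h, hp⟩
  · rintro ⟨hj, hp⟩
    have hjI := hA.1 (Finset.mem_insert_of_mem hj)
    refine ⟨hjI, hp, lt_of_le_of_ne (hmax j hj) fun h => ha ?_⟩
    exact hN.2.2.2.2 j hjI a (hA.1 (Finset.mem_insert_self _ _)) h ▸ hj

theorem IsInitial.of_insert {N : TIN ν ι} {A : Finset ι} {a : ι}
    (hmax : ∀ j ∈ A, N.τ j ≤ N.τ a) (hA : N.IsInitial (insert a A)) : N.IsInitial A := by
  refine ⟨(Finset.subset_insert a A).trans hA.1, fun j hj i hi hlt => ?_⟩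
  rcases Finset.mem_insert.1 (hA.2 j hj i (Finset.mem_insert_of_mem hi) hlt) with rfl | h
  · exact absurd hlt (hmax i hi).not_gt
  · exact h

theorem isInitial_univ (N : TIN ν ι) : N.IsInitial N.I :=
  ⟨subset_rfl, fun _ hj _ _ _ => hj⟩

/-- The greedy assignment never overdraws a buffer. -/
theorem sum_src_greedy_le_sum_dest (N : TIN ν ι) (hN : N.Valid) (A : Finset ι) :
    N.IsInitial A → (∀ i ∈ A, 0 ≤ N.greedy i) ∧ ∀ v, v ≠ N.s →
      ∑ j ∈ A with N.src j = v, N.greedy j ≤ ∑ j ∈ A with N.dest j = v, N.greedy j := by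
  induction A using Finset.induction_on_max_value N.τ with
  | empty => simp
  | insert a A ha hmax ih =>
    intro hA
    have haI : a ∈ N.I := hA.1 (Finset.mem_insert_self _ _)
    obtain ⟨hpos, hle⟩ := ih (hA.of_insert hmax)
    have hg := N.greedy_apply hN haI
    rw [IsInitial.filter_lt hN ha hmax hA, IsInitial.filter_lt hN ha hmax hA] at hg
    have hq := (hN.2.2.2.1 a haI).2.2.2.1
    have hga : 0 ≤ N.greedy a := by
      rw [hg]
      split_ifs with h
      · exact hq
      · exact le_min hq (sub_nonneg.2 (hle _ h))
    refine ⟨fun i hi => ?_, fun v hv => ?_⟩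
    · rcases Finset.mem_insert.1 hi with rfl | hi
      · exact hga
      · exact hpos i hi
    · have hsum : ∀ p : ι → Prop, ∑ j ∈ insert a A with p j, N.greedy j
          = (if p a then N.greedy a else 0) + ∑ j ∈ A with p j, N.greedy j := by
        intro p
        rw [Finset.filter_insert]
        split_ifs with h
        · rw [Finset.sum_insert (by simp [ha])]
        · rw [zero_add]
      rw [hsum, hsum]
      have hd : 0 ≤ if N.dest a = v then N.greedy a else 0 := by
        split_ifs
        · exact hga
        · exact le_rfl
      by_cases hsv : N.src a = v
      · rw [if_neg (hsv ▸ hv), hsv] at hg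
        rw [if_pos hsv]
        have := hg.le.trans (min_le_right _ _)
        linarith
      · rw [if_neg hsv]
        linarith [hle v hv]

theorem greedy_isFlow (N : TIN ν ι) (hN : N.Valid) : N.IsFlow N.greedy := by
  refine ⟨fun i hi => ⟨(N.sum_src_greedy_le_sum_dest hN _ N.isInitial_univ).1 i hi, ?_⟩,
    fun i hi h => ?_, fun i hi h => ?_⟩
  · rw [N.greedy_apply hN hi]
    split_ifs
    · exact le_rfl
    · exact min_le_left _ _
  · rw [N.greedy_apply hN hi, if_pos h]
  · have := N.greedy_apply hN hi
    rw [if_neg h] at this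
    exact this.le.trans (min_le_right _ _)

/-- When each vertex other than the source has at most one out-neighbour, comparing the
amounts sent by all vertices suffices to compare the amounts received. -/
theorem sum_dest_le_sum_dest (N : TIN ν ι)
    (hout : ∀ i ∈ N.I, ∀ j ∈ N.I, N.src i ≠ N.s → N.src i = N.src j → N.dest i = N.dest j)
    {x y : ι → ℝ} (hxy : ∀ i ∈ N.I, N.src i = N.s → x i ≤ y i)
    {A : Finset ι} (hA : A ⊆ N.I)
    (hsrc : ∀ v, v ≠ N.s → ∑ j ∈ A with N.src j = v, x j ≤ ∑ j ∈ A with N.src j = v, y j)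
    (v : ν) : ∑ j ∈ A with N.dest j = v, x j ≤ ∑ j ∈ A with N.dest j = v, y j := by
  have hmaps : ∀ j ∈ A.filter (fun j => N.dest j = v), N.src j ∈ A.image N.src := fun j hj =>
    Finset.mem_image_of_mem _ (Finset.mem_filter.1 hj).1
  rw [← Finset.sum_fiberwise_of_maps_to hmaps, ← Finset.sum_fiberwise_of_maps_to hmaps]
  refine Finset.sum_le_sum fun u _ => ?_
  by_cases hu : u = N.s
  · refine Finset.sum_le_sum fun j hj => ?_
    simp only [Finset.mem_filter] at hj
    exact hxy j (hA hj.1.1) (hj.2.trans hu)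
  · by_cases he : ∃ i ∈ A, N.dest i = v ∧ N.src i = u
    · obtain ⟨i, hi, rfl, rfl⟩ := he
      have : (A.filter fun j => N.dest j = N.dest i).filter (fun j => N.src j = N.src i)
          = A.filter fun j => N.src j = N.src i := by
        ext j
        simp only [Finset.mem_filter]
        exact ⟨fun h => ⟨h.1.1, h.2⟩, fun h =>
          ⟨⟨h.1, (hout i (hA hi) j (hA h.1) hu h.2.symm).symm⟩, h.2⟩⟩
      rw [this]
      exact hsrc _ hu
    · have : (A.filter fun j => N.dest j = v).filter (fun j => N.src j = u) = ∅ := by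
        ext j
        simp only [Finset.mem_filter, Finset.notMem_empty, iff_false]
        exact fun h => he ⟨j, h.1.1, h.1.2, h.2⟩
      rw [this, Finset.sum_empty, Finset.sum_empty]

/-- At every moment, every vertex has sent at least as much under the greedy assignment as
under any other flow assignment. -/
theorem sum_src_le_sum_src_greedy (N : TIN ν ι) (hN : N.Valid)
    (hout : ∀ i ∈ N.I, ∀ j ∈ N.I, N.src i ≠ N.s → N.src i = N.src j → N.dest i = N.dest j)
    {x : ι → ℝ} (hx : N.IsFlow x) (A : Finset ι) :
    N.IsInitial A → ∀ v, v ≠ N.s →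
      ∑ j ∈ A with N.src j = v, x j ≤ ∑ j ∈ A with N.src j = v, N.greedy j := by
  induction A using Finset.induction_on_max_value N.τ with
  | empty => simp
  | insert a A ha hmax ih =>
    intro hA v hv
    have haI : a ∈ N.I := hA.1 (Finset.mem_insert_self _ _)
    have hA' := hA.of_insert hmax
    have hle := ih hA'
    by_cases hsv : N.src a = v
    · subst hsv
      have hin := N.sum_dest_le_sum_dest hout (fun i hi h =>
        ((hx.2.1 i hi h).trans ((N.greedy_isFlow hN).2.1 i hi h).symm).le) hA'.1 hle (N.src a)
      have hg := N.greedy_apply hN haI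
      have hxa := hx.2.2 a haI hv
      rw [IsInitial.filter_lt hN ha hmax hA, IsInitial.filter_lt hN ha hmax hA] at hg hxa
      rw [if_neg hv] at hg
      rw [Finset.filter_insert, if_pos rfl, Finset.sum_insert (by simp [ha]),
        Finset.sum_insert (by simp [ha]), hg, ← sub_le_iff_le_add]
      have hq := (hx.1 a haI).2
      have := hle _ hv
      apply le_min <;> linarith
    · rw [Finset.filter_insert, if_neg hsv]
      exact hle v hv

end TIN

/-- If the directed graph on `V` with edges
`{(src i, dest i) : i ∈ I}` is acyclic and every vertex other than `s` and `t`
has exactly one outgoing edge (its set of out-neighbours is a singleton), then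
the greedy algorithm computes the maximum flow. -/
theorem greedy_eq_maxFlow_of_unique_out (ν ι : Type) (N : TIN ν ι) (hN : N.Valid)
    (hacyc : ∀ v : ν,
      ¬ Relation.TransGen (fun a b => ∃ i ∈ N.I, N.src i = a ∧ N.dest i = b) v v)
    (hout : ∀ v ∈ N.V, v ≠ N.s → v ≠ N.t →
      ∃! u : ν, ∃ i ∈ N.I, N.src i = v ∧ N.dest i = u) :
    N.val N.greedy = N.maxFlow := by
  have hdest : ∀ i ∈ N.I, ∀ j ∈ N.I, N.src i ≠ N.s → N.src i = N.src j →
      N.dest i = N.dest j := fun i hi j hj hs hij =>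
    (hout _ (hN.2.2.2.1 i hi).1 hs (hN.2.2.2.1 i hi).2.2.2.2.2).unique
      ⟨i, hi, rfl, rfl⟩ ⟨j, hj, hij.symm, rfl⟩
  have hg := N.greedy_isFlow hN
  refine (IsGreatest.csSup_eq (s := {r : ℝ | ∃ x, N.IsFlow x ∧ N.val x = r}) ⟨⟨N.greedy, hg, rfl⟩, ?_⟩).symm
  rintro _ ⟨x, hx, rfl⟩
  exact N.sum_dest_le_sum_dest hdest
    (fun i hi h => ((hx.2.1 i hi h).trans (hg.2.1 i hi h).symm).le) subset_rfl
    (N.sum_src_le_sum_src_greedy hN hdest hx _ N.isInitial_univ) N.t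
end
end

section
/- Let G be a temporal interaction network containing a chain s = u_0, u_1, …, u_k of pairwise distinct vertices originating from the source s, with k ≥ 2, u_1, …, u_{k−1} ∉ {s, t}, such that for every j with 1 ≤ j ≤ k−1: every interaction with destination u_j has source u_{j−1}, and every interaction with source u_j has destination u_{j+1}; moreover every interaction with source s and destination u_1 belongs to the chain. Let C ⊆ I be the set of interactions whose source and destination are consecutive chain vertices (u_{j}, u_{j+1}) for some 0 ≤ j < k, let g_C be the greedy assignment of the chain subnetwork (vertex set {u_0, …, u_k}, interaction set C, source s, sink u_k), and let G′ be the network with vertex set V \ {u_1, …, u_{k−1}}, the same source s and sink t, and interaction set (I \ C) together with, for each interaction i ∈ C with dest(i) = u_k and g_C(i) > 0, a new interaction from s to u_k with timestamp τ(i) and quantity g_C(i). Then the maximum flow of G′ equals the maximum flow of G. -/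
noncomputable section
attribute [local instance] Classical.propDecidable

namespace TIN

variable {ν ι : Type}

/-- The set `C` of interactions that lie on the chain `u 0, u 1, …, u k`,
i.e. whose source and destination are consecutive chain vertices. -/
def chainInteractions (N : TIN ν ι) (k : ℕ) (u : ℕ → ν) : Finset ι :=
  N.I.filter fun i => ∃ j < k, N.src i = u j ∧ N.dest i = u (j + 1)

/-- The chain subnetwork: vertex set `{u 0, …, u k}`, interaction set `C`,
source `s`, sink `u k`. -/
def chainSubnet (N : TIN ν ι) (k : ℕ) (u : ℕ → ν) : TIN ν ι :=
  { V := (Finset.range (k + 1)).image u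
    I := N.chainInteractions k u
    s := N.s
    t := u k
    src := N.src
    dest := N.dest
    τ := N.τ
    q := N.q }

/-- The reduced network `G′`: delete the interior chain vertices
`u 1, …, u (k-1)`, delete the chain interactions `C`, and add, for each
interaction `i ∈ C` with destination `u k` and positive greedy value `g_C i`,
a new interaction from `s` to `u k` with timestamp `τ i` and quantity `g_C i`.
Old interactions are indexed by `Sum.inl`, new ones by `Sum.inr`. -/
def chainReduced (N : TIN ν ι) (k : ℕ) (u : ℕ → ν) : TIN ν (ι ⊕ ι) :=
  let C := N.chainInteractions k u
  let gC := (N.chainSubnet k u).greedy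
  { V := N.V \ ((Finset.Ioo 0 k).image u)
    I := ((N.I \ C).image Sum.inl) ∪
         ((C.filter fun i => N.dest i = u k ∧ 0 < gC i).image Sum.inr)
    s := N.s
    t := N.t
    src := Sum.elim N.src fun _ => N.s
    dest := Sum.elim N.dest fun _ => u k
    τ := Sum.elim N.τ N.τ
    q := Sum.elim N.q gC }

end TIN

namespace TIN

variable {ν ι : Type}

/-- The invariant of the greedy algorithm after the interactions in `F` have been processed. -/
structure GreedyInv (M : TIN ν ι) (F : Finset ι) (gB : (ι → ℝ) × (ν → ℝ)) : Prop where
  eq_of_src : ∀ i ∈ F, M.src i = M.s → gB.1 i = M.q i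
  eq_min : ∀ i ∈ F, M.src i ≠ M.s → gB.1 i = min (M.q i)
    ((∑ j ∈ F.filter fun j => M.dest j = M.src i ∧ M.τ j < M.τ i, gB.1 j)
      - (∑ j ∈ F.filter fun j => M.src j = M.src i ∧ M.τ j < M.τ i, gB.1 j))
  buffer_eq : ∀ v, v ≠ M.s → gB.2 v =
    (∑ j ∈ F.filter fun j => M.dest j = v, gB.1 j) - (∑ j ∈ F.filter fun j => M.src j = v, gB.1 j)
  buffer_nonneg : ∀ v, v ≠ M.s → 0 ≤ gB.2 v
  nonneg : ∀ i ∈ F, 0 ≤ gB.1 i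

theorem sum_filter_insert_update {F : Finset ι} {a : ι} (ha : a ∉ F) (f : ι → ℝ) (c : ℝ)
    (P : ι → Prop) [DecidablePred P] :
    ∑ j ∈ (insert a F).filter P, Function.update f a c j
      = (∑ j ∈ F.filter P, f j) + if P a then c else 0 := by
  rw [Finset.sum_filter, Finset.sum_insert ha, Finset.sum_filter, add_comm]
  congr 1
  · refine Finset.sum_congr rfl fun j hj => ?_
    rw [Function.update_of_ne fun h : j = a => ha (h ▸ hj)]
  · simp

theorem GreedyInv.step {M : TIN ν ι} {F : Finset ι} {gB : (ι → ℝ) × (ν → ℝ)}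
    (h : M.GreedyInv F gB) {a : ι} (hlt : ∀ j ∈ F, M.τ j < M.τ a) (hq : 0 ≤ M.q a) :
    M.GreedyInv (insert a F) (M.greedyStep gB a) := by
  have ha : a ∉ F := fun h => lt_irrefl _ (hlt a h)
  obtain ⟨f, B⟩ := gB
  obtain ⟨h1, h2, h3, h4, h5⟩ := h
  simp only at h1 h2 h3 h4 h5
  set c : ℝ := if M.src a = M.s then M.q a else min (M.q a) (B (M.src a)) with hc
  have hc0 : 0 ≤ c := by
    rw [hc]; split_ifs with hs
    · exact hq
    · exact le_min hq (h4 _ hs)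
  have hne : ∀ j ∈ F, j ≠ a := fun j hj e => ha (e ▸ hj)
  refine ⟨?_, ?_, ?_, ?_, ?_⟩ <;> simp only [greedyStep, ← hc]
  · intro i hi hs
    rcases Finset.mem_insert.1 hi with rfl | hi
    · simp [hc, hs]
    · rw [Function.update_of_ne (hne i hi), h1 i hi hs]
  · intro i hi hs
    rw [sum_filter_insert_update ha, sum_filter_insert_update ha]
    rcases Finset.mem_insert.1 hi with rfl | hi
    · rw [Function.update_self, hc, if_neg hs, h3 _ hs]
      simp only [lt_irrefl, and_false, if_false, add_zero]
      congr 2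
      · refine Finset.sum_congr (Finset.filter_congr fun j hj => ?_) fun _ _ => rfl
        simp [hlt j hj]
      · refine Finset.sum_congr (Finset.filter_congr fun j hj => ?_) fun _ _ => rfl
        simp [hlt j hj]
    · rw [Function.update_of_ne (hne i hi), h2 i hi hs]
      simp [not_lt.2 (hlt i hi).le]
  · intro v hv
    rw [sum_filter_insert_update ha, sum_filter_insert_update ha, h3 v hv]
    have e1 : (v = M.dest a) = (M.dest a = v) := propext eq_comm
    have e2 : (v = M.src a ∧ M.src a ≠ M.s) = (M.src a = v) :=
      propext ⟨fun h => h.1.symm, fun h => ⟨h.symm, h ▸ hv⟩⟩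
    simp only [e1, e2]
    ring
  · intro v hv
    have h4v := h4 v hv
    have h6 : (if v = M.src a ∧ M.src a ≠ M.s then c else 0) ≤ B v := by
      split_ifs with h
      · rw [hc, if_neg h.2, h.1]
        exact min_le_right _ _
      · exact h4v
    have h7 : 0 ≤ (if v = M.dest a then c else 0) := by split_ifs <;> simp [hc0]
    linarith
  · intro i hi
    rcases Finset.mem_insert.1 hi with rfl | hi
    · simpa using hc0
    · rw [Function.update_of_ne (hne i hi)]
      exact h5 i hi

theorem greedyInv_foldl (M : TIN ν ι) (l : List ι) (hl : l.Pairwise fun a b => M.τ a < M.τ b)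
    (hq : ∀ i ∈ l, 0 ≤ M.q i) :
    M.GreedyInv l.toFinset (l.foldl M.greedyStep (fun _ => 0, fun _ => 0)) := by
  induction l using List.reverseRecOn with
  | nil => constructor <;> simp
  | append_singleton l a ih =>
    rw [List.pairwise_append] at hl
    have := (ih hl.1 fun i hi => hq i (by simp [hi])).step (a := a)
      (fun j hj => hl.2.2 j (List.mem_toFinset.1 hj) a (by simp)) (hq a (by simp))
    have e : (l ++ [a]).toFinset = insert a l.toFinset := by ext; simp
    rw [List.foldl_append, e]
    exact this

theorem exists_greedyInv (M : TIN ν ι) (hq : ∀ i ∈ M.I, 0 ≤ M.q i)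
    (hτ : ∀ i ∈ M.I, ∀ j ∈ M.I, M.τ i = M.τ j → i = j) :
    ∃ B, M.GreedyInv M.I (M.greedy, B) := by
  have hmem : ∀ i, i ∈ M.sortedI ↔ i ∈ M.I := fun i => by simp [sortedI]
  have hle : M.sortedI.Pairwise fun a b => M.τ a ≤ M.τ b := by
    have := List.pairwise_mergeSort (le := fun a b => decide (M.τ a ≤ M.τ b))
      (fun a b c hab hbc => by simp only [decide_eq_true_eq] at *; exact hab.trans hbc)
      (fun a b => by simpa using le_total (M.τ a) (M.τ b)) M.I.toList
    simpa [sortedI] using this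
  have hnd : M.sortedI.Nodup := by
    rw [sortedI, (List.mergeSort_perm _ _).nodup_iff]
    exact M.I.nodup_toList
  have hlt : M.sortedI.Pairwise fun a b => M.τ a < M.τ b :=
    (hle.and hnd).imp_of_mem fun {a b} ha hb h => lt_of_le_of_ne h.1 fun e =>
      h.2 (hτ a ((hmem a).1 ha) b ((hmem b).1 hb) e)
  have := M.greedyInv_foldl M.sortedI hlt fun i hi => hq i ((hmem i).1 hi)
  have e : M.sortedI.toFinset = M.I := by ext i; simp [hmem]
  rw [e] at this
  exact ⟨_, this⟩

theorem GreedyInv.isFlow {M : TIN ν ι} {g : ι → ℝ} {B : ν → ℝ} (h : M.GreedyInv M.I (g, B)) :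
    M.IsFlow g := by
  refine ⟨fun i hi => ⟨h.nonneg i hi, ?_⟩, h.eq_of_src, fun i hi hs => ?_⟩
  · by_cases hs : M.src i = M.s
    · exact (h.eq_of_src i hi hs).le
    · exact (h.eq_min i hi hs).trans_le (min_le_left _ _)
  · exact (h.eq_min i hi hs).trans_le (min_le_right _ _)

/-- If at each time the next term of `x` is at most that of `g`, or the running total of `x` is at
most that of `g`, then the totals compare. -/
theorem sum_le_sum_of_running (τ x g : ι → ℝ) (S : Finset ι)
    (hτ : ∀ i ∈ S, ∀ j ∈ S, τ i = τ j → i = j)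
    (h : ∀ i ∈ S, x i ≤ g i ∨ x i + ∑ j ∈ S.filter (fun j => τ j < τ i), x j
      ≤ g i + ∑ j ∈ S.filter (fun j => τ j < τ i), g j) :
    ∑ i ∈ S, x i ≤ ∑ i ∈ S, g i := by
  induction S using Finset.induction_on_max_value τ with
  | empty => simp
  | insert a S ha hmax ih =>
    have hlt : ∀ j ∈ S, τ j < τ a := fun j hj => lt_of_le_of_ne (hmax j hj) fun e =>
      ha (hτ j (by simp [hj]) a (by simp) e ▸ hj)
    have ih' := ih (fun i hi j hj => hτ i (by simp [hi]) j (by simp [hj])) fun i hi => by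
      have := h i (by simp [hi])
      rwa [Finset.filter_insert, if_neg (not_lt.2 (hlt i hi).le)] at this
    rw [Finset.sum_insert ha, Finset.sum_insert ha]
    rcases h a (by simp) with h' | h'
    · exact add_le_add h' ih'
    · rwa [Finset.filter_insert, if_neg (lt_irrefl _), Finset.filter_true_of_mem hlt] at h'

/-- On a chain, the greedy assignment delivers to every chain vertex, up to any time, at least as
much as any flow assignment. -/
theorem IsFlow.sum_le_greedy {M : TIN ν ι} {k : ℕ} {u : ℕ → ν}
    (hτ : ∀ i ∈ M.I, ∀ j ∈ M.I, M.τ i = M.τ j → i = j)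
    (hinj : ∀ a ≤ k, ∀ b ≤ k, u a = u b → a = b) (hu0 : u 0 = M.s)
    (hchain : ∀ i ∈ M.I, ∃ j < k, M.src i = u j ∧ M.dest i = u (j + 1))
    {g x : ι → ℝ} {B : ν → ℝ} (hg : M.GreedyInv M.I (g, B)) (hx : M.IsFlow x)
    (m : ℕ) (hm : m < k) (p : ℝ → Prop) (hp : ∀ a b, a < b → p b → p a) :
    ∑ i ∈ M.I.filter (fun i => M.dest i = u (m + 1) ∧ p (M.τ i)), x i
      ≤ ∑ i ∈ M.I.filter (fun i => M.dest i = u (m + 1) ∧ p (M.τ i)), g i := by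
  have hsrc : ∀ m < k, ∀ i ∈ M.I, M.dest i = u (m + 1) ↔ M.src i = u m := by
    intro m hm i hi
    obtain ⟨j, hj, h1, h2⟩ := hchain i hi
    rw [h1, h2]
    constructor
    · intro h
      have := hinj _ (by omega) _ (by omega) h
      rw [Nat.add_right_cancel this]
    · intro h
      rw [hinj _ (by omega) _ (by omega) h]
  induction m generalizing p with
  | zero =>
    refine (Finset.sum_congr rfl fun i hi => ?_).le
    obtain ⟨hi, hd, -⟩ := Finset.mem_filter.1 hi
    have hs : M.src i = M.s := by rw [← hu0]; exact (hsrc 0 hm i hi).1 hd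
    rw [hx.2.1 i hi hs]
    exact (hg.eq_of_src i hi hs).symm
  | succ m ih =>
    apply sum_le_sum_of_running M.τ
    · intro i hi j hj
      exact hτ i (Finset.mem_filter.1 hi).1 j (Finset.mem_filter.1 hj).1
    · intro i hi
      obtain ⟨hi, hd, hpi⟩ := Finset.mem_filter.1 hi
      have hsi := (hsrc _ hm i hi).1 hd
      have hs : M.src i ≠ M.s := by
        rw [hsi, ← hu0]
        intro h
        have := hinj _ (by omega) _ (by omega) h
        omega
      have e : (M.I.filter fun i => M.dest i = u (m + 1 + 1) ∧ p (M.τ i)).filter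
          (fun j => M.τ j < M.τ i) = M.I.filter fun j => M.src j = M.src i ∧ M.τ j < M.τ i := by
        rw [Finset.filter_filter]
        refine Finset.filter_congr fun j hj => ?_
        rw [hsi, hsrc _ hm j hj]
        exact ⟨fun h => ⟨h.1.1, h.2⟩, fun h => ⟨⟨h.1, hp _ _ h.2 hpi⟩, h.2⟩⟩
      rw [e]
      have hgi := hg.eq_min i hi hs
      simp only at hgi
      rcases min_choice (M.q i) ((∑ j ∈ M.I.filter fun j => M.dest j = M.src i ∧ M.τ j < M.τ i, g j)
        - (∑ j ∈ M.I.filter fun j => M.src j = M.src i ∧ M.τ j < M.τ i, g j)) with h | h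
      · left
        rw [hgi, h]
        exact (hx.1 i hi).2
      · right
        rw [h] at hgi
        have h1 := hx.2.2 i hi hs
        have h2 := ih (by omega) (fun r => r < M.τ i) fun a b hab hb => hab.trans hb
        rw [← hsi] at h2
        linarith

theorem bddAbove_val (M : TIN ν ι) : BddAbove {r : ℝ | ∃ x, M.IsFlow x ∧ M.val x = r} := by
  refine ⟨∑ i ∈ M.I.filter fun i => M.dest i = M.t, M.q i, ?_⟩
  rintro r ⟨x, hx, rfl⟩
  exact Finset.sum_le_sum fun i hi => (hx.1 i (Finset.mem_filter.1 hi).1).2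

theorem exists_isFlow (M : TIN ν ι) (hq : ∀ i ∈ M.I, 0 ≤ M.q i) : ∃ x, M.IsFlow x := by
  refine ⟨fun i => if M.src i = M.s then M.q i else 0, fun i hi => ?_, fun i hi hs => if_pos hs,
    fun i hi hs => ?_⟩
  · have := hq i hi
    dsimp only
    split_ifs <;> simp [this]
  · have h1 : ∑ j ∈ M.I.filter (fun j => M.src j = M.src i ∧ M.τ j < M.τ i),
        (if M.src j = M.s then M.q j else 0) = 0 := by
      refine Finset.sum_eq_zero fun j hj => if_neg ?_
      rw [(Finset.mem_filter.1 hj).2.1]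
      exact hs
    dsimp only
    rw [h1, if_neg hs, sub_zero]
    refine Finset.sum_nonneg fun j hj => ?_
    have := hq j (Finset.mem_filter.1 hj).1
    split_ifs <;> simp [this]

theorem maxFlow_le_maxFlow {κ : Type} {M : TIN ν ι} {M' : TIN ν κ} (hq : ∀ i ∈ M.I, 0 ≤ M.q i)
    (h : ∀ x, M.IsFlow x → ∃ y, M'.IsFlow y ∧ M.val x ≤ M'.val y) : M.maxFlow ≤ M'.maxFlow := by
  obtain ⟨x₀, hx₀⟩ := M.exists_isFlow hq
  refine csSup_le ⟨_, x₀, hx₀, rfl⟩ ?_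
  rintro r ⟨x, hx, rfl⟩
  obtain ⟨y, hy, hle⟩ := h x hx
  exact hle.trans (le_csSup M'.bddAbove_val ⟨y, hy, rfl⟩)

theorem sum_filter_chainReduced (N : TIN ν ι) (k : ℕ) (u : ℕ → ν) (P : ι ⊕ ι → Prop)
    [DecidablePred P] (y : ι ⊕ ι → ℝ) :
    ∑ j ∈ (N.chainReduced k u).I.filter P, y j
      = ∑ i ∈ (N.I \ N.chainInteractions k u).filter (fun i => P (Sum.inl i)), y (Sum.inl i)
        + ∑ i ∈ (N.chainInteractions k u).filter (fun i => (N.dest i = u k ∧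
            0 < (N.chainSubnet k u).greedy i) ∧ P (Sum.inr i)), y (Sum.inr i) := by
  have hd : Disjoint ((N.I \ N.chainInteractions k u).image (Sum.inl : ι → ι ⊕ ι))
      (((N.chainInteractions k u).filter fun i => N.dest i = u k ∧
        0 < (N.chainSubnet k u).greedy i).image Sum.inr) := by
    rw [Finset.disjoint_left]
    intro a ha hb
    obtain ⟨i, -, rfl⟩ := Finset.mem_image.1 ha
    obtain ⟨j, -, h⟩ := Finset.mem_image.1 hb
    cases h
  rw [← Finset.filter_filter, Finset.sum_filter, Finset.sum_filter, Finset.sum_filter fun i => P (Sum.inr i)]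
  simp only [chainReduced]
  rw [Finset.sum_union hd, Finset.sum_image fun _ _ _ _ h => Sum.inl_injective h,
    Finset.sum_image fun _ _ _ _ h => Sum.inr_injective h]

theorem sum_filter_split_chain (N : TIN ν ι) (k : ℕ) (u : ℕ → ν) (P : ι → Prop)
    [DecidablePred P] (x : ι → ℝ) :
    ∑ i ∈ N.I.filter P, x i = ∑ i ∈ (N.I \ N.chainInteractions k u).filter P, x i
      + ∑ i ∈ (N.chainInteractions k u).filter P, x i := by
  simp only [Finset.sum_filter]
  exact (Finset.sum_sdiff (Finset.filter_subset _ _)).symm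

end TIN

/-- reducing a chain `s = u 0, u 1, …, u k` that originates from
the source to a single edge from `s` to `u k`, whose interactions are the
greedy deliveries of the chain subnetwork into `u k`, does not change the
maximum flow. -/
theorem maxFlow_chainReduced (ν ι : Type) (N : TIN ν ι) (hN : N.Valid)
    (k : ℕ) (hk : 2 ≤ k) (u : ℕ → ν)
    (hinj : ∀ a ≤ k, ∀ b ≤ k, u a = u b → a = b)
    (hu0 : u 0 = N.s)
    (humem : ∀ j ≤ k, u j ∈ N.V)
    (hmid : ∀ j, 1 ≤ j → j ≤ k - 1 → u j ≠ N.s ∧ u j ≠ N.t)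
    (hin : ∀ i ∈ N.I, ∀ j, 1 ≤ j → j ≤ k - 1 → N.dest i = u j → N.src i = u (j - 1))
    (hout : ∀ i ∈ N.I, ∀ j, 1 ≤ j → j ≤ k - 1 → N.src i = u j → N.dest i = u (j + 1))
    (hfirst : ∀ i ∈ N.I, N.src i = N.s → N.dest i = u 1 →
      i ∈ N.chainInteractions k u) :
    (N.chainReduced k u).maxFlow = N.maxFlow := by
  obtain ⟨-, -, -, hI, hτ⟩ := hN
  set C := N.chainInteractions k u with hC
  set g := (N.chainSubnet k u).greedy with hgdef
  have hCI : ∀ i ∈ C, i ∈ N.I := fun i hi => (Finset.mem_filter.1 hi).1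
  have hCc : ∀ i ∈ C, ∃ j < k, N.src i = u j ∧ N.dest i = u (j + 1) :=
    fun i hi => (Finset.mem_filter.1 hi).2
  have hτC : ∀ i ∈ C, ∀ j ∈ C, N.τ i = N.τ j → i = j :=
    fun i hi j hj => hτ i (hCI i hi) j (hCI j hj)
  obtain ⟨B, hg⟩ := (N.chainSubnet k u).exists_greedyInv
    (fun i hi => (hI i (hCI i hi)).2.2.2.1) hτC
  rw [← hgdef] at hg
  have hg0 : ∀ i ∈ C, 0 ≤ g i := hg.nonneg
  have hgF : (N.chainSubnet k u).IsFlow g := hg.isFlow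
  have hsrcC : ∀ i ∈ N.I, ∀ j, 1 ≤ j → j ≤ k - 1 → N.src i = u j → i ∈ C := fun i hi j h1 h2 h =>
    Finset.mem_filter.2 ⟨hi, j, by omega, h, hout i hi j h1 h2 h⟩
  have hdestC : ∀ i ∈ N.I, ∀ j, 1 ≤ j → j ≤ k - 1 → N.dest i = u j → i ∈ C :=
    fun i hi j h1 h2 h => Finset.mem_filter.2 ⟨hi, j - 1, by omega, hin i hi j h1 h2 h, by
      rw [h]; congr 1; omega⟩
  have hsrcN : ∀ i ∈ C, N.src i ≠ N.s → ∃ j, 1 ≤ j ∧ j ≤ k - 1 ∧ N.src i = u j := by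
    intro i hi hs
    obtain ⟨j, hj, h1, -⟩ := hCc i hi
    refine ⟨j, ?_, by omega, h1⟩
    by_contra h0
    obtain rfl : j = 0 := by omega
    exact hs (h1.trans hu0)
  -- Vertices outside the interior of the chain receive chain interactions only if equal to `u k`.
  have hdestN : ∀ v, (∀ j, 1 ≤ j → j ≤ k - 1 → v ≠ u j) → ∀ i ∈ C, N.dest i = v → v = u k := by
    intro v hv i hi h
    obtain ⟨j, hj, -, h2⟩ := hCc i hi
    by_cases hjk : j + 1 = k
    · rw [← h, h2, hjk]
    · exact absurd (h.symm.trans h2) (hv (j + 1) (by omega) (by omega))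
  have hin_red : ∀ v, (∀ j, 1 ≤ j → j ≤ k - 1 → v ≠ u j) → ∀ (p : ℝ → Prop) (y : ι ⊕ ι → ℝ),
      (∀ i ∈ C, N.dest i = u k → 0 < g i → y (Sum.inr i) = g i) →
      ∑ j ∈ (N.chainReduced k u).I.filter (fun j => (N.chainReduced k u).dest j = v ∧
          p ((N.chainReduced k u).τ j)), y j
        = ∑ i ∈ (N.I \ C).filter (fun i => N.dest i = v ∧ p (N.τ i)), y (Sum.inl i)
          + ∑ i ∈ C.filter (fun i => N.dest i = v ∧ p (N.τ i)), g i := by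
    intro v hv p y hy
    rw [TIN.sum_filter_chainReduced]
    congr 1
    rw [Finset.sum_filter, Finset.sum_filter]
    refine Finset.sum_congr rfl fun i hi => ?_
    have h0 := hg0 i hi
    have h1 := hdestN v hv i hi
    change (if (N.dest i = u k ∧ 0 < g i) ∧ u k = v ∧ p (N.τ i) then y (Sum.inr i) else 0) = _
    by_cases hd : N.dest i = v ∧ p (N.τ i)
    · have hvk := h1 hd.1
      rw [if_pos hd]
      by_cases hpos : 0 < g i
      · rw [if_pos ⟨⟨hd.1.trans hvk, hpos⟩, hvk.symm, hd.2⟩, hy i hi (hd.1.trans hvk) hpos]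
      · rw [if_neg fun h => hpos h.1.2]
        linarith
    · rw [if_neg hd, if_neg fun h => hd ⟨h.1.1.trans h.2.1, h.2.2⟩]
  have hout_red : ∀ v, v ≠ N.s → ∀ (p : ℝ → Prop) (y : ι ⊕ ι → ℝ),
      ∑ j ∈ (N.chainReduced k u).I.filter (fun j => (N.chainReduced k u).src j = v ∧
          p ((N.chainReduced k u).τ j)), y j
        = ∑ i ∈ (N.I \ C).filter (fun i => N.src i = v ∧ p (N.τ i)), y (Sum.inl i) := by
    intro v hv p y
    rw [TIN.sum_filter_chainReduced]
    refine add_eq_left.2 (Finset.sum_eq_zero fun i hi => ?_)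
    exact absurd (Finset.mem_filter.1 hi).2.2.1.symm hv
  have hout_N : ∀ v, v ≠ N.s → (∀ j, 1 ≤ j → j ≤ k - 1 → v ≠ u j) →
      ∀ (p : ℝ → Prop) (x : ι → ℝ), ∑ j ∈ N.I.filter (fun j => N.src j = v ∧ p (N.τ j)), x j
        = ∑ i ∈ (N.I \ C).filter (fun i => N.src i = v ∧ p (N.τ i)), x i := by
    intro v hvs hv p x
    rw [N.sum_filter_split_chain k u]
    refine add_eq_left.2 (Finset.sum_eq_zero fun i hi => ?_)
    obtain ⟨hi, h, -⟩ := Finset.mem_filter.1 hi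
    obtain ⟨j, h1, h2, h3⟩ := hsrcN i hi (h ▸ hvs)
    exact absurd (h.symm.trans h3) (hv j h1 h2)
  have hmem_inl : ∀ i, Sum.inl i ∈ (N.chainReduced k u).I ↔ i ∈ N.I ∧ i ∉ C := fun i => by
    simp [TIN.chainReduced, hC]
  have hmem_inr : ∀ i, Sum.inr i ∈ (N.chainReduced k u).I ↔ i ∈ C ∧ N.dest i = u k ∧ 0 < g i :=
    fun i => by simp [TIN.chainReduced, hC, hgdef]
  have hnonint : ∀ i ∈ N.I, i ∉ C → ∀ j, 1 ≤ j → j ≤ k - 1 → N.src i ≠ u j :=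
    fun i hi hiC j h1 h2 h => hiC (hsrcC i hi j h1 h2 h)
  have ht : ∀ j, 1 ≤ j → j ≤ k - 1 → N.t ≠ u j := fun j h1 h2 h => (hmid j h1 h2).2 h.symm
  have hfil_in : ∀ i ∈ C, N.src i ≠ N.s →
      N.I.filter (fun j => N.dest j = N.src i ∧ N.τ j < N.τ i)
        = C.filter (fun j => N.dest j = N.src i ∧ N.τ j < N.τ i) := by
    intro i hi hs
    obtain ⟨m, h1, h2, h3⟩ := hsrcN i hi hs
    ext j
    simp only [Finset.mem_filter, h3]
    exact ⟨fun h => ⟨hdestC j h.1 m h1 h2 h.2.1, h.2⟩, fun h => ⟨hCI j h.1, h.2⟩⟩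
  have hfil_out : ∀ i ∈ C, N.src i ≠ N.s →
      N.I.filter (fun j => N.src j = N.src i ∧ N.τ j < N.τ i)
        = C.filter (fun j => N.src j = N.src i ∧ N.τ j < N.τ i) := by
    intro i hi hs
    obtain ⟨m, h1, h2, h3⟩ := hsrcN i hi hs
    ext j
    simp only [Finset.mem_filter, h3]
    exact ⟨fun h => ⟨hsrcC j h.1 m h1 h2 h.2.1, h.2⟩, fun h => ⟨hCI j h.1, h.2⟩⟩
  apply le_antisymm
  · refine TIN.maxFlow_le_maxFlow ?_ fun y hy => ?_
    · rintro (i | i) hi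
      · exact (hI i ((hmem_inl i).1 hi).1).2.2.2.1
      · exact hg0 i ((hmem_inr i).1 hi).1
    · have hyg : ∀ i ∈ C, N.dest i = u k → 0 < g i → y (Sum.inr i) = g i := fun i hi hd hp =>
        hy.2.1 (Sum.inr i) ((hmem_inr i).2 ⟨hi, hd, hp⟩) rfl
      let x : ι → ℝ := fun i => if i ∈ C then g i else y (Sum.inl i)
      have hxC : ∀ i ∈ C, x i = g i := fun i hi => if_pos hi
      have hxN : ∀ i, i ∉ C → x i = y (Sum.inl i) := fun i hi => if_neg hi
      have hsumC : ∀ (P : ι → Prop) [DecidablePred P],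
          ∑ i ∈ C.filter P, x i = ∑ i ∈ C.filter P, g i := fun P _ =>
        Finset.sum_congr rfl fun i hi => hxC i (Finset.mem_filter.1 hi).1
      have hsumN : ∀ (P : ι → Prop) [DecidablePred P],
          ∑ i ∈ (N.I \ C).filter P, x i = ∑ i ∈ (N.I \ C).filter P, y (Sum.inl i) := fun P _ =>
        Finset.sum_congr rfl fun i hi => hxN i (Finset.mem_sdiff.1 (Finset.mem_filter.1 hi).1).2
      refine ⟨x, ⟨fun i hi => ?_, fun i hi hs => ?_, fun i hi hs => ?_⟩, ?_⟩
      · by_cases hiC : i ∈ C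
        · rw [hxC i hiC]; exact hgF.1 i hiC
        · rw [hxN i hiC]; exact hy.1 _ ((hmem_inl i).2 ⟨hi, hiC⟩)
      · by_cases hiC : i ∈ C
        · rw [hxC i hiC]; exact hgF.2.1 i hiC hs
        · rw [hxN i hiC]; exact hy.2.1 _ ((hmem_inl i).2 ⟨hi, hiC⟩) hs
      · by_cases hiC : i ∈ C
        · rw [hxC i hiC, hfil_in i hiC hs, hfil_out i hiC hs, hsumC, hsumC]
          exact hgF.2.2 i hiC hs
        · have h := hy.2.2 _ ((hmem_inl i).2 ⟨hi, hiC⟩) hs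
          have e1 := hin_red (N.src i) (hnonint i hi hiC) (fun r => r < N.τ i) y hyg
          have e2 := hout_red (N.src i) hs (fun r => r < N.τ i) y
          have h' := h.trans_eq (congrArg₂ (· - ·) e1 e2)
          rw [hxN i hiC, hout_N _ hs (hnonint i hi hiC) (fun r => r < N.τ i),
            N.sum_filter_split_chain k u, hsumC, hsumN, hsumN]
          exact h'
      · have e1 := hin_red N.t ht (fun _ => True) y hyg
        simp only [and_true] at e1
        refine (e1.trans ?_).le
        rw [TIN.val, N.sum_filter_split_chain k u, hsumC, hsumN]
  · refine TIN.maxFlow_le_maxFlow (fun i hi => (hI i hi).2.2.2.1) fun x hx => ?_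
    have hxF : (N.chainSubnet k u).IsFlow x := by
      refine ⟨fun i hi => hx.1 i (hCI i hi), fun i hi => hx.2.1 i (hCI i hi), fun i hi hs => ?_⟩
      have h := hx.2.2 i (hCI i hi) hs
      rw [hfil_in i hi hs, hfil_out i hi hs] at h
      exact h
    have hdom : ∀ v, (∀ j, 1 ≤ j → j ≤ k - 1 → v ≠ u j) → ∀ p : ℝ → Prop,
        (∀ a b, a < b → p b → p a) →
        ∑ i ∈ C.filter (fun i => N.dest i = v ∧ p (N.τ i)), x i
          ≤ ∑ i ∈ C.filter (fun i => N.dest i = v ∧ p (N.τ i)), g i := by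
      intro v hv p hp
      by_cases hvk : v = u k
      · have := TIN.IsFlow.sum_le_greedy (M := N.chainSubnet k u) hτC hinj hu0 hCc hg hxF (k - 1) (by omega) p hp
        rw [Nat.sub_add_cancel (by omega)] at this
        rw [hvk]
        exact this
      · exact Finset.sum_le_sum fun i hi => absurd
          (hdestN v hv i (Finset.mem_filter.1 hi).1 (Finset.mem_filter.1 hi).2.1) hvk
    refine ⟨Sum.elim x g, ⟨?_, ?_, ?_⟩, ?_⟩
    · rintro (i | i) hi
      · exact hx.1 i ((hmem_inl i).1 hi).1
      · exact ⟨hg0 i ((hmem_inr i).1 hi).1, le_rfl⟩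
    · rintro (i | i) hi hs
      · exact hx.2.1 i ((hmem_inl i).1 hi).1 hs
      · rfl
    · rintro (i | i) hi hs
      · obtain ⟨hiI, hiC⟩ := (hmem_inl i).1 hi
        have hs' : N.src i ≠ N.s := hs
        have hni := hnonint i hiI hiC
        have e1 := hin_red (N.src i) hni (fun r => r < N.τ i) (Sum.elim x g) fun _ _ _ _ => rfl
        have e2 := hout_red (N.src i) hs (fun r => r < N.τ i) (Sum.elim x g)
        have h := hx.2.2 i hiI hs'
        rw [hout_N _ hs' hni (fun r => r < N.τ i), N.sum_filter_split_chain k u] at h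
        have hd := hdom (N.src i) hni (fun r => r < N.τ i) fun a b hab hb => hab.trans hb
        refine le_trans ?_ (congrArg₂ (· - ·) e1 e2).ge
        exact h.trans (sub_le_sub_right (add_le_add_right hd _) _)
      · exact absurd rfl hs
    · have e1 := hin_red N.t ht (fun _ => True) (Sum.elim x g) fun _ _ _ _ => rfl
      have hd := hdom N.t ht (fun _ => True) fun _ _ _ h => h
      simp only [and_true] at e1 hd
      refine le_trans ?_ e1.ge
      rw [TIN.val, N.sum_filter_split_chain k u]
      exact add_le_add_right hd _
end
end

section
/- Let i₀ ∈ I be an interaction with src(i₀) = v where v ≠ s, and suppose τ(i₀) < τ(j) for every interaction j ∈ I with dest(j) = v. Then x(i₀) = 0 for every flow assignment x, and the network obtained by deleting i₀ from I (keeping everything else unchanged) has the same maximum flow as the original network. -/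
noncomputable section
attribute [local instance] Classical.propDecidable

namespace TIN

/-- The network obtained by deleting the interaction `i₀`. -/
abbrev eraseI {ν ι : Type} (N : TIN ν ι) (i₀ : ι) : TIN ν ι :=
  { N with I := N.I.erase i₀ }

/-- An interaction out of a non-source vertex that precedes every interaction into that vertex
carries no flow. -/
theorem IsFlow.eq_zero_of_early {ν ι : Type} {N : TIN ν ι} {x : ι → ℝ} (hx : N.IsFlow x)
    {i : ι} (hi : i ∈ N.I) (hs : N.src i ≠ N.s)
    (hτ : ∀ j ∈ N.I, N.dest j = N.src i → N.τ i < N.τ j) : x i = 0 := by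
  have hle := hx.2.2 i hi hs
  rw [Finset.filter_false_of_mem (fun j hj h => lt_asymm h.2 (hτ j hj h.1)),
    Finset.sum_empty] at hle
  have hnn : 0 ≤ ∑ j ∈ N.I.filter fun j => N.src j = N.src i ∧ N.τ j < N.τ i, x j :=
    Finset.sum_nonneg fun j hj => (hx.1 j (Finset.mem_of_mem_filter j hj)).1
  linarith [(hx.1 i hi).1]

theorem sum_filter_congr {ν ι : Type} {N : TIN ν ι} {x y : ι → ℝ} (h : ∀ i ∈ N.I, x i = y i)
    (p : ι → Prop) [DecidablePred p] : ∑ j ∈ N.I.filter p, x j = ∑ j ∈ N.I.filter p, y j :=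
  Finset.sum_congr rfl fun j hj => h j (Finset.mem_of_mem_filter j hj)

theorem IsFlow.congr {ν ι : Type} {N : TIN ν ι} {x y : ι → ℝ} (hx : N.IsFlow x)
    (h : ∀ i ∈ N.I, x i = y i) : N.IsFlow y := by
  refine ⟨fun i hi => h i hi ▸ hx.1 i hi, fun i hi => h i hi ▸ hx.2.1 i hi, fun i hi hs => ?_⟩
  rw [← sum_filter_congr h, ← sum_filter_congr h, ← h i hi]
  exact hx.2.2 i hi hs

theorem sum_filter_eraseI {ν ι : Type} (N : TIN ν ι) {i₀ : ι} {x : ι → ℝ} (h : x i₀ = 0)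
    (p : ι → Prop) [DecidablePred p] :
    ∑ j ∈ (N.eraseI i₀).I.filter p, x j = ∑ j ∈ N.I.filter p, x j := by
  rw [Finset.filter_erase, Finset.sum_erase _ h]

theorem val_eraseI {ν ι : Type} (N : TIN ν ι) {i₀ : ι} {x : ι → ℝ} (h : x i₀ = 0) :
    (N.eraseI i₀).val x = N.val x :=
  N.sum_filter_eraseI h _

theorem IsFlow.eraseI {ν ι : Type} {N : TIN ν ι} {i₀ : ι} {x : ι → ℝ} (hx : N.IsFlow x)
    (h : x i₀ = 0) : (N.eraseI i₀).IsFlow x := by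
  refine ⟨fun i hi => hx.1 i (Finset.mem_of_mem_erase hi),
    fun i hi => hx.2.1 i (Finset.mem_of_mem_erase hi), fun i hi hs => ?_⟩
  rw [N.sum_filter_eraseI h, N.sum_filter_eraseI h]
  exact hx.2.2 i (Finset.mem_of_mem_erase hi) hs

/-- A flow on the network without an early interaction `i₀` is a flow on the whole network as soon
as it vanishes at `i₀`. -/
theorem IsFlow.of_eraseI {ν ι : Type} {N : TIN ν ι} {i₀ : ι} {x : ι → ℝ}
    (hx : (N.eraseI i₀).IsFlow x) (h : x i₀ = 0) (hq : 0 ≤ N.q i₀) (hs : N.src i₀ ≠ N.s)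
    (hτ : ∀ j ∈ N.I, N.dest j = N.src i₀ → N.τ i₀ < N.τ j) : N.IsFlow x := by
  refine ⟨fun i hi => ?_, fun i hi his => ?_, fun i hi his => ?_⟩
  · rcases eq_or_ne i i₀ with rfl | hne
    · exact ⟨h.ge, h.trans_le hq⟩
    · exact hx.1 i (Finset.mem_erase.2 ⟨hne, hi⟩)
  · exact hx.2.1 i (Finset.mem_erase.2 ⟨fun e => hs (e ▸ his), hi⟩) his
  · rcases eq_or_ne i i₀ with rfl | hne
    · rw [Finset.filter_false_of_mem (fun j hj hji => lt_asymm hji.2 (hτ j hj hji.1)),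
        Finset.sum_empty, h, Finset.sum_eq_zero, sub_zero]
      intro j hj
      obtain ⟨hj, hsrc, hlt⟩ := Finset.mem_filter.1 hj
      exact hx.eq_zero_of_early (Finset.mem_erase.2 ⟨fun e => hlt.ne (e ▸ rfl), hj⟩)
        (hsrc.trans_ne his) fun k hk hd =>
          hlt.trans (hτ k (Finset.mem_of_mem_erase hk) (hd.trans hsrc))
    · rw [← N.sum_filter_eraseI h, ← N.sum_filter_eraseI h]
      exact hx.2.2 i (Finset.mem_erase.2 ⟨hne, hi⟩) his

end TIN

/-- an interaction `i₀` out of a non-source vertex `v` whose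
timestamp precedes that of every interaction into `v` carries zero flow in
every flow assignment, and deleting it does not change the maximum flow. -/
theorem maxFlow_erase_early_interaction (ν ι : Type) (N : TIN ν ι) (hN : N.Valid)
    (i₀ : ι) (hi₀ : i₀ ∈ N.I) (v : ν) (hsrc : N.src i₀ = v) (hv : v ≠ N.s)
    (hτ : ∀ j ∈ N.I, N.dest j = v → N.τ i₀ < N.τ j) :
    (∀ x : ι → ℝ, N.IsFlow x → x i₀ = 0) ∧
    ({ N with I := N.I.erase i₀ } : TIN ν ι).maxFlow = N.maxFlow := by
  subst hsrc
  have hzero : ∀ x : ι → ℝ, N.IsFlow x → x i₀ = 0 := fun x hx => hx.eq_zero_of_early hi₀ hv hτ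
  refine ⟨hzero, congrArg sSup (Set.ext fun r => ⟨?_, ?_⟩)⟩
  · rintro ⟨y, hy, rfl⟩
    have hyx : ∀ i ∈ (N.eraseI i₀).I, y i = Function.update y i₀ 0 i := fun i hi =>
      (Function.update_of_ne (Finset.ne_of_mem_erase hi) _ _).symm
    have h0 : Function.update y i₀ 0 i₀ = 0 := Function.update_self ..
    refine ⟨_, (hy.congr hyx).of_eraseI h0 (hN.2.2.2.1 i₀ hi₀).2.2.2.1 hv hτ, ?_⟩
    rw [← N.val_eraseI h0]
    exact (TIN.sum_filter_congr hyx _).symm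
  · rintro ⟨x, hx, rfl⟩
    exact ⟨x, hx.eraseI (hzero x hx), N.val_eraseI (hzero x hx)⟩
end
end

section
/- Let v ∈ V \ {s, t} be a vertex such that no interaction in I has src(i) = v (v has no outgoing edges). Then the network obtained by deleting v and all interactions with dest(i) = v has the same maximum flow as the original network. -/
noncomputable section
attribute [local instance] Classical.propDecidable

/-- In a flow, a vertex other than the source has never sent more than it has received. -/
theorem TIN.IsFlow.sent_le_received {ν ι : Type} {N : TIN ν ι} {x : ι → ℝ} (hx : N.IsFlow x)
    (hτ : ∀ i ∈ N.I, ∀ j ∈ N.I, N.τ i = N.τ j → i = j) {u : ν} (hu : u ≠ N.s) (T : ℝ) :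
    ∑ j ∈ N.I.filter (fun j => N.src j = u ∧ N.τ j < T), x j ≤
      ∑ j ∈ N.I.filter (fun j => N.dest j = u ∧ N.τ j < T), x j := by
  obtain ⟨h0, -, hbuf⟩ := hx
  rcases (N.I.filter (fun j => N.src j = u ∧ N.τ j < T)).eq_empty_or_nonempty with he | hne
  · rw [he, Finset.sum_empty]
    exact Finset.sum_nonneg fun j hj => (h0 j (Finset.mem_filter.1 hj).1).1
  · obtain ⟨k, hk, hmax⟩ := Finset.exists_max_image _ N.τ hne
    obtain ⟨hkI, rfl, hkT⟩ := Finset.mem_filter.1 hk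
    have hsplit : N.I.filter (fun j => N.src j = N.src k ∧ N.τ j < T) =
        insert k (N.I.filter (fun j => N.src j = N.src k ∧ N.τ j < N.τ k)) := by
      ext j
      simp only [Finset.mem_insert, Finset.mem_filter]
      constructor
      · intro hj
        rcases (hmax j (Finset.mem_filter.2 hj)).lt_or_eq with h | h
        · exact Or.inr ⟨hj.1, hj.2.1, h⟩
        · exact Or.inl (hτ j hj.1 k hkI h)
      · rintro (rfl | ⟨hj, hs, ht⟩)
        · exact ⟨hkI, rfl, hkT⟩
        · exact ⟨hj, hs, ht.trans hkT⟩
    rw [hsplit, Finset.sum_insert (by simp)]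
    have hmono : ∑ j ∈ N.I.filter (fun j => N.dest j = N.src k ∧ N.τ j < N.τ k), x j ≤
        ∑ j ∈ N.I.filter (fun j => N.dest j = N.src k ∧ N.τ j < T), x j := by
      refine Finset.sum_le_sum_of_subset_of_nonneg ?_
        fun j hj _ => (h0 j (Finset.mem_filter.1 hj).1).1
      intro j
      simp only [Finset.mem_filter]
      exact fun ⟨hj, hd, ht⟩ => ⟨hj, hd, ht.trans hkT⟩
    linarith [hbuf k hkI hu]

/-- deleting a non-source, non-sink vertex `v` with no outgoing
interactions, together with all its incoming interactions, does not change the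
maximum flow. -/
theorem maxFlow_erase_vertex_no_outgoing (ν ι : Type) (N : TIN ν ι) (hN : N.Valid)
    (v : ν) (hvV : v ∈ N.V) (hvs : v ≠ N.s) (hvt : v ≠ N.t)
    (hnoout : ∀ i ∈ N.I, N.src i ≠ v) :
    ({ N with V := N.V.erase v,
              I := N.I.filter fun i => N.dest i ≠ v } : TIN ν ι).maxFlow = N.maxFlow := by
  have hfilter : ∀ (P : ι → Prop) [DecidablePred P], (∀ j, P j → N.dest j ≠ v) →
      (N.I.filter fun i => N.dest i ≠ v).filter P = N.I.filter P := by
    intro P _ hP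
    ext j
    simp only [Finset.mem_filter]
    exact ⟨fun h => ⟨h.1.1, h.2⟩, fun h => ⟨⟨h.1, hP j h.2⟩, h.2⟩⟩
  have hin : ∀ i ∈ N.I, ((N.I.filter fun i => N.dest i ≠ v).filter
      fun j => N.dest j = N.src i ∧ N.τ j < N.τ i) =
        N.I.filter fun j => N.dest j = N.src i ∧ N.τ j < N.τ i :=
    fun i hi => hfilter _ fun _ hj h => hnoout i hi (hj.1.symm.trans h)
  have hsink : ((N.I.filter fun i => N.dest i ≠ v).filter fun j => N.dest j = N.t) =
      N.I.filter fun j => N.dest j = N.t :=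
    hfilter _ fun _ hj h => hvt (h.symm.trans hj)
  unfold TIN.maxFlow
  congr 1
  ext r
  constructor
  · rintro ⟨y, hy, rfl⟩
    have hsent := fun (u : ν) (hu : u ≠ N.s) => hy.sent_le_received
      (fun i hi j hj => hN.2.2.2.2 i (Finset.mem_filter.1 hi).1 j (Finset.mem_filter.1 hj).1) hu
    obtain ⟨h0, hs, hbuf⟩ := hy
    dsimp only at h0 hs hbuf hsent
    let x : ι → ℝ := fun i => if N.dest i ≠ v then y i else if N.src i = N.s then N.q i else 0
    have hxy : ∀ i, N.dest i ≠ v → x i = y i := fun i hi => if_pos hi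
    have hx : ∀ i, N.dest i = v → x i = if N.src i = N.s then N.q i else 0 :=
      fun i hi => if_neg (not_not.2 hi)
    have hin' : ∀ i ∈ N.I, ∑ j ∈ N.I.filter (fun j => N.dest j = N.src i ∧ N.τ j < N.τ i), x j =
        ∑ j ∈ (N.I.filter fun i => N.dest i ≠ v).filter
          (fun j => N.dest j = N.src i ∧ N.τ j < N.τ i), y j := by
      intro i hi
      rw [← hin i hi]
      exact Finset.sum_congr rfl fun j hj =>
        hxy j (Finset.mem_filter.1 (Finset.mem_filter.1 hj).1).2
    have hout : ∀ i, N.src i ≠ N.s →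
        ∑ j ∈ N.I.filter (fun j => N.src j = N.src i ∧ N.τ j < N.τ i), x j =
        ∑ j ∈ (N.I.filter fun i => N.dest i ≠ v).filter
          (fun j => N.src j = N.src i ∧ N.τ j < N.τ i), y j := by
      intro i hi
      rw [Finset.filter_comm, Finset.sum_filter (fun i => N.dest i ≠ v)]
      refine Finset.sum_congr rfl fun j hj => ?_
      have hj' := (Finset.mem_filter.1 hj).2.1
      by_cases hd : N.dest j = v
      · rw [hx j hd, if_neg (hj' ▸ hi), if_neg (not_not.2 hd)]
      · rw [hxy j hd, if_pos hd]
    refine ⟨x, ⟨fun i hi => ?_, fun i hi his => ?_, fun i hi his => ?_⟩, ?_⟩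
    · have hq := (hN.2.2.2.1 i hi).2.2.2.1
      by_cases hd : N.dest i = v
      · rw [hx i hd]
        split_ifs
        · exact ⟨hq, le_rfl⟩
        · exact ⟨le_rfl, hq⟩
      · rw [hxy i hd]
        exact h0 i (Finset.mem_filter.2 ⟨hi, hd⟩)
    · by_cases hd : N.dest i = v
      · rw [hx i hd, if_pos his]
      · rw [hxy i hd]
        exact hs i (Finset.mem_filter.2 ⟨hi, hd⟩) his
    · rw [hin' i hi, hout i his]
      by_cases hd : N.dest i = v
      · rw [hx i hd, if_neg his]
        exact sub_nonneg.2 (hsent _ his _)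
      · rw [hxy i hd]
        exact hbuf i (Finset.mem_filter.2 ⟨hi, hd⟩) his
    · unfold TIN.val
      dsimp only
      rw [← hsink]
      exact Finset.sum_congr rfl fun j hj =>
        hxy j (Finset.mem_filter.1 (Finset.mem_filter.1 hj).1).2
  · rintro ⟨x, ⟨h0, hs, hbuf⟩, rfl⟩
    refine ⟨x, ⟨fun i hi => h0 i (Finset.mem_filter.1 hi).1,
      fun i hi => hs i (Finset.mem_filter.1 hi).1, fun i hi his => ?_⟩, ?_⟩
    · have hiI := (Finset.mem_filter.1 hi).1
      refine (hbuf i hiI his).trans ?_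
      dsimp only
      rw [hin i hiI]
      refine sub_le_sub_left (Finset.sum_le_sum_of_subset_of_nonneg
        (Finset.filter_subset_filter _ (Finset.filter_subset _ _)) fun j hj _ => ?_) _
      exact (h0 j (Finset.mem_filter.1 hj).1).1
    · unfold TIN.val
      dsimp only
      rw [hsink]
end
end

section
/- Fixing the quantities of interactions originating from the source is without loss of generality: the supremum of val(x) over relaxed assignments x equals the maximum flow, i.e., the supremum of val(x) over flow assignments (which additionally satisfy x(i) = q(i) whenever src(i) = s). -/
noncomputable section
attribute [local instance] Classical.propDecidable

/-- A relaxed assignment: conditions (i) and (iii) of a flow assignment, but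
interactions leaving the source need not carry their full quantity. -/
def TIN.IsRelaxed {ν ι : Type} (N : TIN ν ι) (x : ι → ℝ) : Prop :=
  (∀ i ∈ N.I, 0 ≤ x i ∧ x i ≤ N.q i) ∧
  (∀ i ∈ N.I, N.src i ≠ N.s →
    x i ≤ (∑ j ∈ N.I.filter fun j => N.dest j = N.src i ∧ N.τ j < N.τ i, x j)
        - (∑ j ∈ N.I.filter fun j => N.src j = N.src i ∧ N.τ j < N.τ i, x j))

namespace TIN

variable {ν ι : Type} {N : TIN ν ι} {x : ι → ℝ}

theorem IsFlow.isRelaxed (h : N.IsFlow x) : N.IsRelaxed x :=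
  ⟨h.1, h.2.2⟩

theorem isRelaxed_zero (hq : ∀ i ∈ N.I, 0 ≤ N.q i) : N.IsRelaxed fun _ => 0 :=
  ⟨fun i hi => ⟨le_rfl, hq i hi⟩, fun _ _ _ => by simp⟩

theorem IsRelaxed.val_le (h : N.IsRelaxed x) :
    N.val x ≤ ∑ i ∈ N.I.filter fun i => N.dest i = N.t, N.q i :=
  Finset.sum_le_sum fun i hi => (h.1 i (Finset.mem_filter.mp hi).1).2

/-- Raise every interaction leaving the source to its full quantity. -/
def saturate (N : TIN ν ι) (x : ι → ℝ) (i : ι) : ℝ :=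
  if N.src i = N.s then N.q i else x i

theorem IsRelaxed.le_saturate (h : N.IsRelaxed x) {i : ι} (hi : i ∈ N.I) :
    x i ≤ N.saturate x i := by
  unfold saturate
  split_ifs
  exacts [(h.1 i hi).2, le_rfl]

/-- Saturating the source only increases what the other vertices receive, and
leaves what they send unchanged. -/
theorem IsRelaxed.isFlow_saturate (h : N.IsRelaxed x) : N.IsFlow (N.saturate x) := by
  refine ⟨fun i hi => ⟨(h.1 i hi).1.trans (h.le_saturate hi), ?_⟩,
    fun i _ hs => if_pos hs, fun i hi hs => ?_⟩
  · unfold saturate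
    split_ifs
    exacts [le_rfl, (h.1 i hi).2]
  · rw [saturate, if_neg hs]
    refine (h.2 i hi hs).trans (sub_le_sub ?_ (le_of_eq ?_))
    · exact Finset.sum_le_sum fun j hj => h.le_saturate (Finset.mem_filter.mp hj).1
    · refine Finset.sum_congr rfl fun j hj => if_neg ?_
      rwa [(Finset.mem_filter.mp hj).2.1]

theorem IsRelaxed.val_le_val_saturate (h : N.IsRelaxed x) :
    N.val x ≤ N.val (N.saturate x) :=
  Finset.sum_le_sum fun _ hi => h.le_saturate (Finset.mem_filter.mp hi).1

end TIN

/-- fixing the quantities of interactions leaving the source is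
without loss of generality: the supremum of the values of relaxed assignments
equals the maximum flow. -/
theorem relaxed_sup_eq_maxFlow (ν ι : Type) (N : TIN ν ι) (hN : N.Valid) :
    sSup {r : ℝ | ∃ x, N.IsRelaxed x ∧ N.val x = r} = N.maxFlow := by
  have h0 := TIN.isRelaxed_zero (N := N) fun i hi => (hN.2.2.2.1 i hi).2.2.2.1
  have hbdd : BddAbove {r : ℝ | ∃ x, N.IsRelaxed x ∧ N.val x = r} :=
    ⟨_, by rintro _ ⟨x, hx, rfl⟩; exact hx.val_le⟩
  have hsub : {r : ℝ | ∃ x, N.IsFlow x ∧ N.val x = r} ⊆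
      {r : ℝ | ∃ x, N.IsRelaxed x ∧ N.val x = r} := by
    rintro _ ⟨x, hx, rfl⟩
    exact ⟨x, hx.isRelaxed, rfl⟩
  apply le_antisymm
  · refine csSup_le ⟨_, _, h0, rfl⟩ ?_
    rintro _ ⟨x, hx, rfl⟩
    exact hx.val_le_val_saturate.trans
      (le_csSup (hbdd.mono hsub) ⟨_, hx.isFlow_saturate, rfl⟩)
  · exact csSup_le_csSup hbdd ⟨_, _, h0.isFlow_saturate, rfl⟩ hsub
end
end

section
/- If a temporal interaction network has positive maximum flow, then there exists a time-respecting path from the source to the sink: interactions i₁, …, i_m ∈ I with src(i₁) = s, dest(i_m) = t, dest(i_r) = src(i_{r+1}) for all 1 ≤ r < m, and τ(i₁) < τ(i₂) < … < τ(i_m). -/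
noncomputable section
attribute [local instance] Classical.propDecidable

namespace TIN

variable {ν ι : Type}

/-- An interaction carrying positive flow and not leaving the source is preceded by an interaction
carrying positive flow into its source vertex. -/
theorem IsFlow.exists_pos_pred {N : TIN ν ι} {x : ι → ℝ} (hx : N.IsFlow x) {i : ι}
    (hi : i ∈ N.I) (hpos : 0 < x i) (hs : N.src i ≠ N.s) :
    ∃ j ∈ N.I, 0 < x j ∧ N.dest j = N.src i ∧ N.τ j < N.τ i := by
  have hle := hx.2.2 i hi hs
  have hout : 0 ≤ ∑ j ∈ N.I.filter fun j => N.src j = N.src i ∧ N.τ j < N.τ i, x j :=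
    Finset.sum_nonneg fun j hj => (hx.1 j (Finset.mem_filter.1 hj).1).1
  obtain ⟨j, hj, hjpos⟩ := Finset.exists_lt_of_sum_lt
    (s := N.I.filter fun j => N.dest j = N.src i ∧ N.τ j < N.τ i) (f := fun _ => 0) (g := x)
    (by rw [Finset.sum_const_zero]; linarith)
  obtain ⟨hjI, hdest, hτ⟩ := Finset.mem_filter.1 hj
  exact ⟨j, hjI, hjpos, hdest, hτ⟩

/-- Every interaction carrying positive flow is the last one of a time-respecting path that starts
at the source. -/
theorem IsFlow.exists_temporal_path {N : TIN ν ι} {x : ι → ℝ} (hx : N.IsFlow x) {i : ι}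
    (hi : i ∈ N.I) (hpos : 0 < x i) :
    ∃ (m : ℕ) (p : Fin (m + 1) → ι),
      (∀ r, p r ∈ N.I) ∧ N.src (p 0) = N.s ∧ p (Fin.last m) = i ∧
      ∀ r : Fin m, N.dest (p r.castSucc) = N.src (p r.succ) ∧
        N.τ (p r.castSucc) < N.τ (p r.succ) := by
  induction hn : (N.I.filter fun j => N.τ j < N.τ i).card using Nat.strong_induction_on
    generalizing i with
  | _ n ih =>
    by_cases hs : N.src i = N.s
    · exact ⟨0, fun _ => i, fun _ => hi, hs, rfl, fun r => r.elim0⟩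
    obtain ⟨j, hj, hjpos, hdest, hτ⟩ := hx.exists_pos_pred hi hpos hs
    have hcard : (N.I.filter fun k => N.τ k < N.τ j).card < n := by
      rw [← hn]
      refine Finset.card_lt_card (Finset.ssubset_iff_of_subset ?_ |>.2 ⟨j, ?_, ?_⟩)
      · exact Finset.monotone_filter_right _ fun k _ hk => lt_trans hk hτ
      · exact Finset.mem_filter.2 ⟨hj, hτ⟩
      · simp
    obtain ⟨m, p, hI, h0, hlast, hstep⟩ := ih _ hcard hj hjpos rfl
    refine ⟨m + 1, Fin.snoc (α := fun _ => ι) p i, fun r => ?_, ?_, Fin.snoc_last _ _,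
      fun r => ?_⟩
    · induction r using Fin.lastCases with
      | last => simpa using hi
      | cast r => simpa using hI r
    · rw [← Fin.castSucc_zero, Fin.snoc_castSucc]
      exact h0
    · induction r using Fin.lastCases with
      | last =>
        rw [Fin.snoc_castSucc, Fin.succ_last, Fin.snoc_last, hlast]
        exact ⟨hdest, hτ⟩
      | cast r =>
        rw [Fin.snoc_castSucc, Fin.succ_castSucc, Fin.snoc_castSucc]
        exact hstep r

/-- Positive maximum flow is witnessed by an interaction into the sink carrying positive flow. -/
theorem exists_isFlow_pos_of_pos_maxFlow {N : TIN ν ι} (hpos : 0 < N.maxFlow) :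
    ∃ x, N.IsFlow x ∧ ∃ i ∈ N.I, N.dest i = N.t ∧ 0 < x i := by
  by_contra! h
  refine hpos.not_ge (Real.sSup_nonpos ?_)
  rintro _ ⟨x, hx, rfl⟩
  refine Finset.sum_nonpos fun i hi => ?_
  obtain ⟨hiI, hdest⟩ := Finset.mem_filter.1 hi
  exact h x hx i hiI hdest

end TIN

/-- a network with positive maximum flow contains a
time-respecting path from the source to the sink. -/
theorem exists_temporal_path_of_pos_maxFlow (ν ι : Type) (N : TIN ν ι) (hN : N.Valid)
    (hpos : 0 < N.maxFlow) :
    ∃ (m : ℕ) (p : Fin (m + 1) → ι),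
      (∀ r, p r ∈ N.I) ∧
      N.src (p 0) = N.s ∧
      N.dest (p (Fin.last m)) = N.t ∧
      ∀ r : Fin m, N.dest (p r.castSucc) = N.src (p r.succ) ∧
        N.τ (p r.castSucc) < N.τ (p r.succ) := by
  obtain ⟨x, hx, i, hi, hdest, hi_pos⟩ := TIN.exists_isFlow_pos_of_pos_maxFlow hpos
  obtain ⟨m, p, hI, h0, hlast, hstep⟩ := hx.exists_temporal_path hi hi_pos
  exact ⟨m, p, hI, h0, hlast ▸ hdest, hstep⟩
end
end

section
/- The greedy flow can be arbitrarily smaller than the maximum flow: for every ε > 0 there exists a temporal interaction network whose maximum flow is at least 1 but whose greedy flow val(g) is at most ε. -/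
noncomputable section
attribute [local instance] Classical.propDecidable

/-- If `l` lists the interactions in increasing order of timestamp, then `sortedI` is `l`. -/
theorem TIN.sortedI_eq {ν ι : Type} (N : TIN ν ι) {l : List ι} (hperm : N.I.toList.Perm l)
    (hl : l.Pairwise fun a b => N.τ a < N.τ b) : N.sortedI = l := by
  refine List.Perm.eq_of_pairwise (le := fun a b => N.τ a ≤ N.τ b) ?_ ?_
    (hl.imp le_of_lt) ((List.mergeSort_perm _ _).trans hperm)
  · intro a b ha' hb hab hba
    by_contra hne
    have ha : a ∈ l := ((List.mergeSort_perm _ _).trans hperm).mem_iff.mp ha'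
    have : Std.Symm fun a b => N.τ a ≠ N.τ b := ⟨fun _ _ h => h.symm⟩
    have hτ : l.Pairwise fun a b => N.τ a ≠ N.τ b := hl.imp ne_of_lt
    exact hτ.forall ha hb hne (le_antisymm hab hba)
  · have h := List.pairwise_mergeSort (le := fun a b => decide (N.τ a ≤ N.τ b))
      (by simpa using fun a b c => le_trans) (by simpa using fun a b => le_total _ _) N.I.toList
    simpa [TIN.sortedI] using h

/-- The network with vertices `s = 0`, `a = 1`, `b = 2`, `t = 3` and unit interactions
`s → a`, `a → b`, `a → t`, in this order of time. The greedy algorithm wastes the unit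
received by `a` on the dead end `b`. -/
def deadEndNetwork : TIN (Fin 4) (Fin 3) where
  V := Finset.univ
  I := Finset.univ
  s := 0
  t := 3
  src := ![0, 1, 1]
  dest := ![1, 2, 3]
  τ := fun i => (i : ℕ)
  q := fun _ => 1

theorem deadEndNetwork_valid : deadEndNetwork.Valid := by
  refine ⟨Finset.mem_univ _, Finset.mem_univ _, by simp [deadEndNetwork], ?_, ?_⟩
  · intro i _
    fin_cases i <;> simp [deadEndNetwork]
  · intro i _ j _ h
    exact Fin.ext (by simpa [deadEndNetwork] using h)

theorem deadEndNetwork_val (x : Fin 3 → ℝ) : deadEndNetwork.val x = x 2 := by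
  rw [TIN.val, Finset.sum_filter]
  simp [deadEndNetwork, Fin.sum_univ_three]

theorem one_le_maxFlow_deadEndNetwork : 1 ≤ deadEndNetwork.maxFlow := by
  refine le_csSup ⟨1, ?_⟩ ⟨![1, 0, 1], ⟨?_, ?_, ?_⟩, ?_⟩
  · rintro _ ⟨x, hx, rfl⟩
    rw [deadEndNetwork_val]
    exact (hx.1 2 (Finset.mem_univ _)).2
  · intro i _
    fin_cases i <;> simp [deadEndNetwork]
  · intro i _
    fin_cases i <;> simp [deadEndNetwork]
  · intro i _
    fin_cases i <;> simp [deadEndNetwork, Finset.sum_filter, Fin.sum_univ_three]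
  · simp [deadEndNetwork_val]

theorem deadEndNetwork_sortedI : deadEndNetwork.sortedI = [0, 1, 2] := by
  refine TIN.sortedI_eq _ ?_ ?_
  · rw [List.perm_ext_iff_of_nodup (Finset.nodup_toList _) (by simp)]
    intro i
    fin_cases i <;> simp [deadEndNetwork]
  · simp [deadEndNetwork]

theorem deadEndNetwork_val_greedy : deadEndNetwork.val deadEndNetwork.greedy = 0 := by
  rw [deadEndNetwork_val, TIN.greedy, deadEndNetwork_sortedI]
  simp [TIN.greedyStep, deadEndNetwork]

/-- the greedy flow can be arbitrarily smaller than the maximum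
flow: for every `ε > 0` there is a temporal interaction network with maximum
flow at least `1` whose greedy flow is at most `ε`. -/
theorem greedy_arbitrarily_smaller_than_maxFlow :
    ∀ ε : ℝ, 0 < ε →
      ∃ (ν ι : Type) (N : TIN ν ι), N.Valid ∧
        1 ≤ N.maxFlow ∧ N.val N.greedy ≤ ε := by
  intro ε hε
  exact ⟨_, _, deadEndNetwork, deadEndNetwork_valid, one_le_maxFlow_deadEndNetwork,
    deadEndNetwork_val_greedy.trans_le hε.le⟩
end
end
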